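/- arXiv:math/0508546 — 2 statements merged into one kernel-verified Lean document; each statement's English description precedes it below -/
import Mathlib

section
/- Let p ≠ 5 be an odd prime and let α_p be the unique integer with 1 ≤ α_p ≤ 4 and α_p·p ≡ 1 (mod 5). Then F_p(q) ≡ (5/p) · q^{((5−α_p)p+1)/5} (mod [p]_q) in ℤ[q], where (5/p) is the Legendre symbol and the exponent ((5−α_p)p+1)/5 is an integer. -/
open Polynomial

/-- The Schur q-Fibonacci polynomials: F₀ = 0, F₁ = 1, Fₙ = Fₙ₋₁ + q^(n-2) Fₙ₋₂. -/
noncomputable def qF : ℕ → Polynomial ℤ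
  | 0 => 0
  | 1 => 1
  | n + 2 => qF (n + 1) + X ^ n * qF n
/-- [n]_q = 1 + q + ⋯ + q^(n-1) in ℤ[q]. -/
noncomputable def qbracket (n : ℕ) : Polynomial ℤ := ∑ i ∈ Finset.range n, X ^ i

noncomputable def qb (r : ℂ) : ℕ → ℤ → ℂ
  | 0, m => if m = 0 then 1 else 0
  | n + 1, m => qb r n (m - 1) + r ^ (2 * m) * qb r n m

lemma qb_succ (r : ℂ) (n : ℕ) (m : ℤ) :
    qb r (n + 1) m = qb r n (m - 1) + r ^ (2 * m) * qb r n m := rfl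

lemma qb_neg (r : ℂ) (n : ℕ) : ∀ m : ℤ, m < 0 → qb r n m = 0 := by
  induction n with
  | zero => intro m hm; simp [qb]; omega
  | succ n ih => intro m hm; rw [qb_succ, ih _ (by omega), ih _ hm]; simp

lemma qb_gt (r : ℂ) (n : ℕ) : ∀ m : ℤ, (n : ℤ) < m → qb r n m = 0 := by
  induction n with
  | zero => intro m hm; simp [qb]; push_cast at hm; omega
  | succ n ih =>
    intro m hm
    push_cast at hm
    rw [qb_succ, ih _ (by omega), ih _ (by omega)]; simp

lemma qb_zero_right (r : ℂ) (n : ℕ) : qb r n 0 = 1 := by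
  induction n with
  | zero => simp [qb]
  | succ n ih => rw [qb_succ, ih, qb_neg r n _ (by omega)]; simp

lemma qb_succ' (r : ℂ) (hr : r ≠ 0) (n : ℕ) : ∀ m : ℤ,
    qb r (n + 1) m = qb r n m + r ^ (2 * ((n : ℤ) + 1 - m)) * qb r n (m - 1) := by
  induction n with
  | zero =>
    intro m
    simp only [qb]
    by_cases h0 : m = 0
    · subst h0; simp
    · by_cases h1 : m = 1
      · subst h1; simp
      · have : m - 1 ≠ 0 := by omega
        simp [h0, this]
  | succ n ih =>
    intro m
    have f1 := ih m
    have f2 := ih (m - 1)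
    have g1 := qb_succ r n m
    have g2 := qb_succ r n (m - 1)
    have g3 := qb_succ r (n + 1) m
    have e1 : r ^ (2 * m) * r ^ (2 * ((n : ℤ) + 1 - m)) = r ^ (2 * ((n : ℤ) + 1)) := by
      rw [← zpow_add₀ hr]; congr 1; ring
    have e2 : r ^ (2 * ((n : ℤ) + 1 + 1 - m)) * r ^ (2 * (m - 1)) = r ^ (2 * ((n : ℤ) + 1)) := by
      rw [← zpow_add₀ hr]; congr 1; ring
    have e3 : r ^ (2 * ((n : ℤ) + 1 - (m - 1))) = r ^ (2 * ((n : ℤ) + 1 + 1 - m)) := by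
      congr 1; ring
    rw [e3] at f2
    push_cast
    linear_combination g3 + f2 + r ^ (2 * m) * f1 - g1 -
      r ^ (2 * ((n : ℤ) + 1 + 1 - m)) * g2 + (qb r n (m - 1)) * e1 - (qb r n (m - 1)) * e2

/-- absorption identity, with the bracket written as a difference of powers -/
lemma qb_absorb (r : ℂ) (hr : r ≠ 0) (n : ℕ) : ∀ m : ℤ,
    (1 - r ^ (2 * m)) * qb r (n + 1) m = (1 - r ^ (2 * ((n : ℤ) + 1))) * qb r n (m - 1) := by
  intro m
  have h1 := qb_succ r n m
  have h2 := qb_succ' r hr n m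
  have e1 : r ^ (2 * m) * r ^ (2 * ((n : ℤ) + 1 - m)) = r ^ (2 * ((n : ℤ) + 1)) := by
    rw [← zpow_add₀ hr]; congr 1; ring
  linear_combination h1 - r ^ (2 * m) * h2 - (qb r n (m - 1)) * e1

noncomputable def TT (r : ℂ) (n : ℕ) (j : ℤ) : ℂ :=
  (-1) ^ j * r ^ (j * (5 * j + 1)) * qb r n (((n : ℤ) - 5 * j) / 2)

noncomputable def GG (r : ℂ) (n : ℕ) (j : ℤ) : ℂ :=
  if ((n : ℤ) - 5 * j) % 2 = 0 then
    (-1) ^ j * r ^ (j * (5 * j + 1) + ((n : ℤ) + 2 - 5 * j)) * qb r n (((n : ℤ) + 2 - 5 * j) / 2)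
  else 0

lemma TT_rec (r : ℂ) (hr : r ≠ 0) (n : ℕ) (j : ℤ) :
    TT r (n + 2) j - TT r (n + 1) j - r ^ (2 * ((n : ℤ) + 1)) * TT r n j
      = GG r n j - GG r n (j + 1) := by
  unfold TT GG
  push_cast
  rcases Int.even_or_odd' ((n : ℤ) + 2 - 5 * j) with ⟨m, hm | hm⟩
  · have a1 : ((n : ℤ) + 2 - 5 * j) / 2 = m := by omega
    have a2 : ((n : ℤ) + 1 - 5 * j) / 2 = m - 1 := by omega
    have a3 : ((n : ℤ) - 5 * j) / 2 = m - 1 := by omega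
    rw [if_pos (by omega), if_neg (by omega), a1, a2, a3, hm, qb_succ r (n + 1) m,
      qb_succ' r hr n m, zpow_add₀ hr (j * (5 * j + 1)) (2 * m)]
    have e1 : r ^ (2 * m) * r ^ (2 * ((n : ℤ) + 1 - m)) = r ^ (2 * ((n : ℤ) + 1)) := by
      rw [← zpow_add₀ hr]; congr 1; ring
    rw [← e1]
    ring
  · have a1 : ((n : ℤ) + 2 - 5 * j) / 2 = m := by omega
    have a2 : ((n : ℤ) + 1 - 5 * j) / 2 = m := by omega
    have a3 : ((n : ℤ) - 5 * j) / 2 = m - 1 := by omega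
    have a4 : ((n : ℤ) + 2 - 5 * (j + 1)) / 2 = m - 1 - 1 := by omega
    rw [if_neg (by omega), if_pos (by omega), a1, a2, a3, a4, qb_succ' r hr (n + 1) m,
      qb_succ r n (m - 1)]
    have e1 : r ^ (2 * ((n : ℤ) + 1 + 1 - m)) * r ^ (2 * (m - 1)) = r ^ (2 * ((n : ℤ) + 1)) := by
      rw [← zpow_add₀ hr]; congr 1; ring
    have e2 : r ^ ((j + 1) * (5 * (j + 1) + 1) + ((n : ℤ) + 2 - 5 * (j + 1)))
        = r ^ (j * (5 * j + 1)) * r ^ (2 * ((n : ℤ) + 1 + 1 - m)) := by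
      rw [← zpow_add₀ hr]; congr 1; linear_combination (-1 : ℤ) * hm
    have e3 : (-1 : ℂ) ^ (j + 1) = - (-1) ^ j := by
      rw [zpow_add_one₀ (by norm_num)]; ring
    rw [← e1, e2, e3]
    push_cast
    ring

noncomputable def DD (r : ℂ) (N n : ℕ) : ℂ :=
  ∑ i ∈ Finset.range (2 * N), TT r n ((i : ℤ) - N)

lemma DD_rec (r : ℂ) (hr : r ≠ 0) (N n : ℕ) (h : n + 2 ≤ N) :
    DD r N (n + 2) = DD r N (n + 1) + r ^ (2 * ((n : ℤ) + 1)) * DD r N n := by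
  have key : ∑ i ∈ Finset.range (2 * N), (GG r n ((i : ℤ) - N) - GG r n ((i : ℤ) - N + 1)) = 0 := by
    have := Finset.sum_range_sub' (fun i : ℕ => GG r n ((i : ℤ) - N)) (2 * N)
    have h0 : GG r n (((0 : ℕ) : ℤ) - N) = 0 := by
      unfold GG
      rw [qb_gt r n _ (by push_cast; omega)]; simp
    have h1 : GG r n (((2 * N : ℕ) : ℤ) - N) = 0 := by
      unfold GG
      rw [qb_neg r n _ (by push_cast; omega)]; simp
    rw [h0, h1, sub_zero] at this
    rw [← this]
    refine Finset.sum_congr rfl fun i _ => ?_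
    push_cast
    congr 2
    ring
  have h2 : ∑ i ∈ Finset.range (2 * N), (TT r (n + 2) ((i : ℤ) - N) - TT r (n + 1) ((i : ℤ) - N)
      - r ^ (2 * ((n : ℤ) + 1)) * TT r n ((i : ℤ) - N)) = 0 := by
    rw [← key]
    exact Finset.sum_congr rfl fun i _ => TT_rec r hr n _
  rw [Finset.sum_sub_distrib, Finset.sum_sub_distrib, ← Finset.mul_sum] at h2
  unfold DD
  linear_combination h2

lemma DD_base (r : ℂ) (N n : ℕ) (hN : 1 ≤ N) (hn : n ≤ 1) : DD r N n = 1 := by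
  unfold DD
  rw [Finset.sum_eq_single N]
  · unfold TT
    have : ((n : ℤ) - 5 * ((N : ℤ) - N)) / 2 = 0 := by omega
    rw [this, qb_zero_right]; simp
  · intro i _ hi
    unfold TT
    have hj : ((i : ℤ) - N) ≠ 0 := by omega
    rcases lt_or_gt_of_ne hj with h | h
    · rw [qb_gt r n _ (by omega)]; simp
    · rw [qb_neg r n _ (by omega)]; simp
  · intro h; simp at h; omega

lemma DD_eq (r : ℂ) (hr : r ≠ 0) (N : ℕ) (hN : 1 ≤ N) : ∀ n : ℕ, n ≤ N →
    DD r N n = aeval (r ^ 2) (qF (n + 1)) := by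
  intro n
  induction n using Nat.strong_induction_on with
  | _ n ih =>
    intro hn
    match n, ih, hn with
    | 0, _, _ => rw [DD_base r N 0 hN (by omega)]; simp [qF]
    | 1, _, _ => rw [DD_base r N 1 hN (by omega)]; simp [qF]
    | n + 2, ih, hn =>
      rw [DD_rec r hr N n hn, ih (n + 1) (by omega) (by omega), ih n (by omega) (by omega)]
      have : qF (n + 2 + 1) = qF (n + 1 + 1) + X ^ (n + 1) * qF (n + 1) := by rw [qF]
      rw [this]
      have e : r ^ (2 * ((n : ℤ) + 1)) = (r ^ 2) ^ (n + 1) := by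
        rw [← pow_mul, ← zpow_natCast]; push_cast; rfl
      simp [e]

lemma qb_root (r : ℂ) (hr : r ≠ 0) (p : ℕ) (hp : 0 < p) (hrp : IsPrimitiveRoot (r ^ 2) p) :
    ∀ k : ℕ, k < p → qb r (p - 1) k = (-1) ^ (k : ℤ) * r ^ (-((k : ℤ) * (k + 1))) := by
  intro k
  induction k with
  | zero => intro _; simp [qb_zero_right]
  | succ k ih =>
    intro hk
    have h1 := qb_absorb r hr (p - 1) ((k + 1 : ℕ) : ℤ)
    have h2 : r ^ (2 * (((p - 1 : ℕ) : ℤ) + 1)) = 1 := by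
      have : 2 * (((p - 1 : ℕ) : ℤ) + 1) = ((2 * p : ℕ) : ℤ) := by push_cast; omega
      rw [this, zpow_natCast, pow_mul, hrp.pow_eq_one]
    have h3 : r ^ (2 * ((k + 1 : ℕ) : ℤ)) ≠ 1 := by
      have : 2 * ((k + 1 : ℕ) : ℤ) = ((2 * (k + 1) : ℕ) : ℤ) := by push_cast; rfl
      rw [this, zpow_natCast, pow_mul]
      exact hrp.pow_ne_one_of_pos_of_lt (by omega) hk
    rw [h2, sub_self, zero_mul] at h1
    have h4 := (mul_eq_zero.mp h1).resolve_left (sub_ne_zero.mpr h3.symm)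
    rw [qb_succ] at h4
    have h5 : ((k + 1 : ℕ) : ℤ) - 1 = k := by push_cast; ring
    rw [h5, ih (by omega)] at h4
    have h6 : r ^ (-((k : ℤ) * (k + 1))) =
        r ^ (2 * ((k + 1 : ℕ) : ℤ)) * r ^ (-(((k + 1 : ℕ) : ℤ) * ((k + 1 : ℕ) + 1))) := by
      rw [← zpow_add₀ hr]; congr 1; push_cast; ring
    have h7 : (-1 : ℂ) ^ ((k + 1 : ℕ) : ℤ) = - (-1) ^ (k : ℤ) := by
      push_cast
      rw [zpow_add_one₀ (by norm_num)]; ring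
    have h8 : r ^ (2 * ((k + 1 : ℕ) : ℤ)) ≠ 0 := zpow_ne_zero _ hr
    apply mul_left_cancel₀ h8
    rw [h7]
    rw [h6] at h4
    linear_combination h4

lemma sum_pairs (f : ℕ → ℂ) (n : ℕ) :
    ∑ i ∈ Finset.range (2 * n), f i = ∑ s ∈ Finset.range n, (f (2 * s) + f (2 * s + 1)) := by
  induction n with
  | zero => simp
  | succ n ih =>
    rw [show 2 * (n + 1) = 2 * n + 1 + 1 by ring, Finset.sum_range_succ, Finset.sum_range_succ, ih,
      Finset.sum_range_succ]
    ring

lemma zpow_congr (r : ℂ) (hr : r ≠ 0) (p : ℕ) (h : r ^ p = 1) (a b c : ℤ) (hab : a = b + p * c) :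
    r ^ a = r ^ b := by
  rw [hab, zpow_add₀ hr, zpow_mul, zpow_natCast, h]; simp

/-- nonzero summand -/
lemma TT_val (r : ℂ) (hr : r ≠ 0) (p : ℕ) (hp : 0 < p) (hrp : IsPrimitiveRoot (r ^ 2) p)
    (j k : ℤ) (hk : ((p : ℤ) - 1 - 5 * j) / 2 = k) (h0 : 0 ≤ k) (h1 : k < p) :
    TT r (p - 1) j = (-1) ^ (j + k) * r ^ (j * (5 * j + 1) - k * (k + 1)) := by
  unfold TT
  have : ((p - 1 : ℕ) : ℤ) = p - 1 := by omega
  rw [this, hk]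
  lift k to ℕ using h0
  rw [qb_root r hr p hp hrp k (by omega), sub_eq_add_neg, zpow_add₀ hr, zpow_add₀ (by norm_num)]
  ring

lemma TT_zero (r : ℂ) (p : ℕ) (hp : 0 < p) 
    (j k : ℤ) (hk : ((p : ℤ) - 1 - 5 * j) / 2 = k) (h : k < 0 ∨ p ≤ k) :
    TT r (p - 1) j = 0 := by
  unfold TT
  have : ((p - 1 : ℕ) : ℤ) = p - 1 := by omega
  rw [this, hk]
  rcases h with h | h
  · rw [qb_neg _ _ _ h, mul_zero]
  · rw [qb_gt _ _ _ (by omega), mul_zero]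

lemma pair_cancel (r : ℂ) (hr : r ≠ 0) (p h : ℕ) (hph : p = 2 * h + 1)
    (hrp : IsPrimitiveRoot (r ^ 2) p) (hp1 : r ^ p = 1) (I : ℤ)
    (h1 : ¬ (5 * I = - h ∨ 5 * I = -h + 1 ∨ 5 * I = h + 1 ∨ 5 * I = h + 2)) :
    TT r (p - 1) (2 * I - 1) + TT r (p - 1) (2 * I) = 0 := by
  have k1 : ((p : ℤ) - 1 - 5 * (2 * I - 1)) / 2 = h - 5 * I + 2 := by omega
  have k2 : ((p : ℤ) - 1 - 5 * (2 * I)) / 2 = h - 5 * I := by omega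
  by_cases hc : - (h : ℤ) ≤ 5 * I ∧ 5 * I ≤ h
  · rw [TT_val r hr p (by omega) hrp _ _ k1 (by omega) (by omega),
      TT_val r hr p (by omega) hrp _ _ k2 (by omega) (by omega)]
    have e1 : (-1 : ℂ) ^ (2 * I - 1 + (h - 5 * I + 2)) = - (-1) ^ (2 * I + (h - 5 * I)) := by
      rw [show 2 * I - 1 + ((h : ℤ) - 5 * I + 2) = 2 * I + (h - 5 * I) + 1 by ring,
        zpow_add_one₀ (by norm_num)]
      ring
    have e2 : r ^ ((2 * I - 1) * (5 * (2 * I - 1) + 1) - ((h : ℤ) - 5 * I + 2) * (h - 5 * I + 2 + 1))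
        = r ^ (2 * I * (5 * (2 * I) + 1) - ((h : ℤ) - 5 * I) * (h - 5 * I + 1)) := by
      apply zpow_congr r hr p hp1 _ _ (-2)
      subst hph
      push_cast
      ring
    rw [e1, e2]
    ring
  · rw [TT_zero r p (by omega) _ _ k1 (by omega), TT_zero r p (by omega) _ _ k2 (by omega),
      add_zero]

lemma DD_final (r : ℂ) (hr : r ≠ 0) (p h : ℕ) (hph : p = 2 * h + 1)
    (hrp : IsPrimitiveRoot (r ^ 2) p) (hp1 : r ^ p = 1) (I : ℤ)
    (h1 : (5 * I = - h ∨ 5 * I = -h + 1 ∨ 5 * I = h + 1 ∨ 5 * I = h + 2)) (h5 : h % 5 ≠ 2) :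
    aeval (r ^ 2) (qF p) = TT r (p - 1) (2 * I - 1) + TT r (p - 1) (2 * I) := by
  have := DD_eq r hr (2 * p + 1) (by omega) (p - 1) (by omega)
  rw [Nat.sub_add_cancel (by omega)] at this
  rw [← this]
  unfold DD
  rw [sum_pairs, Finset.sum_eq_single (I + p).toNat]
  · congr 2 <;> push_cast <;> omega
  · intro s _ hs
    have := pair_cancel r hr p h hph hrp hp1 ((s : ℤ) - p) (by omega)
    rw [← this]
    congr 2 <;> push_cast <;> omega
  · intro hh
    simp at hh
    omega

lemma leg5_small (x : ℕ) (h5 : x < 5) : @legendreSym 5 ⟨Nat.prime_five⟩ (x : ℤ) =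
    if x = 1 ∨ x = 4 then 1 else if x = 0 then 0 else -1 := by
  interval_cases x <;> decide

lemma leg5 (p : ℕ) [Fact p.Prime] (hp2 : p ≠ 2) :
    legendreSym p 5 = if p % 5 = 1 ∨ p % 5 = 4 then 1 else if p % 5 = 0 then 0 else -1 := by
  haveI : Fact (Nat.Prime 5) := ⟨by norm_num⟩
  have h := legendreSym.quadratic_reciprocity_one_mod_four (p := 5) (q := p) (by norm_num) hp2
  have h' : legendreSym p 5 = legendreSym 5 p := by exact_mod_cast h
  rw [h', legendreSym.mod]
  have h5 : p % 5 < 5 := Nat.mod_lt _ (by norm_num)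
  have : ((p : ℤ) % ((5 : ℕ) : ℤ)) = ((p % 5 : ℕ) : ℤ) := by push_cast; rfl
  rw [this]
  exact leg5_small _ h5

lemma value_at (p : ℕ) (hp : p.Prime) (hodd : Odd p) (hp5 : p ≠ 5)
    (E : ℕ) (α : ℤ) (hα1 : 1 ≤ α) (hα4 : α ≤ 4) (hE : (5 * E : ℤ) = (5 - α) * p + 1)
    (r : ℂ) (hr : r ≠ 0) 
    (hrp : IsPrimitiveRoot (r ^ 2) p) (hp1 : r ^ p = 1) :
    aeval (r ^ 2) (qF p) = ((@legendreSym p ⟨hp⟩ 5 : ℤ) : ℂ) * (r ^ 2) ^ E := by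
  haveI : Fact p.Prime := ⟨hp⟩
  obtain ⟨h, hph⟩ := hodd
  have hp0 := hp.two_le
  rw [leg5 p (by omega)]
  have hndvd : p % 5 ≠ 0 := by
    intro h0
    have := (Nat.prime_dvd_prime_iff_eq (by norm_num : Nat.Prime 5) hp).mp (Nat.dvd_of_mod_eq_zero h0)
    exact hp5 this.symm
  have hE2 : (r ^ 2) ^ E = r ^ (2 * (E : ℤ)) := by
    rw [← pow_mul, ← zpow_natCast]; push_cast; rfl
  rw [hE2]
  have hcases : h % 5 = 0 ∨ h % 5 = 1 ∨ h % 5 = 3 ∨ h % 5 = 4 := by omega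
  rcases hcases with hc | hc | hc | hc
  · obtain ⟨t, ht⟩ : ∃ t, h = 5 * t := ⟨h / 5, by omega⟩
    have hα : α = 1 := by interval_cases α <;> omega
    subst hα
    have hEt : (E : ℤ) = 8 * t + 1 := by omega
    rw [DD_final r hr p h hph hrp hp1 (-t) (by omega) (by omega),
      TT_zero r p (by omega) _ _ rfl (by omega),
      TT_val r hr p (by omega) hrp _ (10 * t) (by omega) (by omega) (by omega),
      if_pos (by omega), hEt, zero_add,
      zpow_congr r hr p hp1 _ (2 * (8 * t + 1)) (-(8 * t + 2))
        (by subst hph; subst ht; push_cast; ring), Even.neg_one_zpow ⟨4 * t, by ring⟩]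
    simp
  · obtain ⟨t, ht⟩ : ∃ t, h = 5 * t + 1 := ⟨h / 5, by omega⟩
    have hα : α = 2 := by interval_cases α <;> omega
    subst hα
    have hEt : (E : ℤ) = 6 * t + 2 := by omega
    rw [DD_final r hr p h hph hrp hp1 (-t) (by omega) (by omega),
      TT_zero r p (by omega) _ _ rfl (by omega),
      TT_val r hr p (by omega) hrp _ (10 * t + 1) (by omega) (by omega) (by omega),
      if_neg (by omega), if_neg (by omega), hEt, zero_add,
      zpow_congr r hr p hp1 _ (2 * (6 * t + 2)) (-(8 * t + 2))
        (by subst hph; subst ht; push_cast; ring), Odd.neg_one_zpow ⟨4 * t, by ring⟩]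
    simp
  · obtain ⟨t, ht⟩ : ∃ t, h = 5 * t + 3 := ⟨h / 5, by omega⟩
    have hα : α = 3 := by interval_cases α <;> omega
    subst hα
    have hEt : (E : ℤ) = 4 * t + 3 := by omega
    rw [DD_final r hr p h hph hrp hp1 (t + 1) (by omega) (by omega),
      TT_val r hr p (by omega) hrp _ 0 (by omega) (by omega) (by omega),
      TT_zero r p (by omega) _ _ rfl (by omega),
      if_neg (by omega), if_neg (by omega), hEt, add_zero,
      zpow_congr r hr p hp1 _ (2 * (4 * t + 3)) (2 * t)
        (by subst hph; subst ht; push_cast; ring), Odd.neg_one_zpow ⟨t, by ring⟩]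
    simp
  · obtain ⟨t, ht⟩ : ∃ t, h = 5 * t + 4 := ⟨h / 5, by omega⟩
    have hα : α = 4 := by interval_cases α <;> omega
    subst hα
    have hEt : (E : ℤ) = 2 * t + 2 := by omega
    rw [DD_final r hr p h hph hrp hp1 (t + 1) (by omega) (by omega),
      TT_val r hr p (by omega) hrp _ 1 (by omega) (by omega) (by omega),
      TT_zero r p (by omega) _ _ rfl (by omega),
      if_pos (by omega), hEt, add_zero,
      zpow_congr r hr p hp1 _ (2 * (2 * t + 2)) (2 * t)
        (by subst hph; subst ht; push_cast; ring), Even.neg_one_zpow ⟨t + 1, by ring⟩]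
    simp

/-- For an odd prime p ≠ 5 and 1 ≤ α ≤ 4 with α·p ≡ 1 (mod 5), the exponent
((5−α)p+1)/5 is an integer and F_p(q) ≡ (5/p)·q^(((5−α)p+1)/5) (mod [p]_q). -/
theorem qFib_prime_congr (p : ℕ) (hp : p.Prime) (hodd : Odd p) (hp5 : p ≠ 5)
    (α : ℤ) (hα1 : 1 ≤ α) (hα4 : α ≤ 4) (hαp : α * p ≡ 1 [ZMOD 5]) :
    (5 : ℤ) ∣ (5 - α) * p + 1 ∧
      qbracket p ∣
        qF p - C (@legendreSym p ⟨hp⟩ 5) * X ^ (((5 - α) * (p : ℤ) + 1) / 5).toNat := by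
  haveI : Fact p.Prime := ⟨hp⟩
  have hd : (5 : ℤ) ∣ (5 - α) * p + 1 := by
    obtain ⟨c, hc⟩ := hαp.dvd
    exact ⟨p + c, by linear_combination hc⟩
  refine ⟨hd, ?_⟩
  have hpos : 0 < p := hp.pos
  have hr0 := Complex.isPrimitiveRoot_exp p hpos.ne'
  generalize Complex.exp (2 * Real.pi * Complex.I / p) = r at hr0
  have hcop : Nat.Coprime 2 p := Nat.coprime_two_left.mpr hodd
  have hrp := hr0.pow_of_coprime 2 hcop
  have hr : r ≠ 0 := hr0.ne_zero hpos.ne'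
  have hnn : 0 ≤ ((5 - α) * (p : ℤ) + 1) / 5 := by
    apply Int.ediv_nonneg _ (by norm_num)
    have : 0 ≤ (5 - α) * (p : ℤ) := mul_nonneg (by omega) (by omega)
    omega
  have hE : (5 * ((((5 - α) * (p : ℤ) + 1) / 5).toNat : ℕ) : ℤ) = (5 - α) * p + 1 := by
    rw [Int.toNat_of_nonneg hnn]
    exact Int.mul_ediv_cancel' hd
  have hv := value_at p hp hodd hp5 _ α hα1 hα4 hE r hr hrp hr0.pow_eq_one
  have hq : qbracket p = minpoly ℤ (r ^ 2) := by
    rw [← cyclotomic_eq_minpoly hrp hpos, cyclotomic_prime, qbracket]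
  rw [hq]
  apply minpoly.isIntegrallyClosed_dvd (hrp.isIntegral hpos)
  rw [map_sub, hv]
  simp
end

section
/- For every integer n ≥ 0, F̂_{n+1}(q) = Σ_{j : 0 ≤ 2j ≤ n} q^{j²+j} · [n−j choose j]_q in ℤ[q]. -/
open Polynomial

/-- The q-Fibonacci polynomials: F̂₀ = 0, F̂₁ = 1, F̂ₙ = F̂ₙ₋₁ + q^(n-1) F̂ₙ₋₂. -/
noncomputable def qFhat : ℕ → Polynomial ℤ
  | 0 => 0
  | 1 => 1
  | n + 2 => qFhat (n + 1) + X ^ (n + 1) * qFhat n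
/-- The Gaussian (q-)binomial coefficient [n choose m]_q ∈ ℤ[q], defined via the
Pascal-type recurrence [n+1 choose m]_q = q^m [n choose m]_q + [n choose m-1]_q;
it equals ((1-q^n)⋯(1-q^(n-m+1)))/((1-q^m)⋯(1-q)) for 0 ≤ m ≤ n and is 0 for m > n. -/
noncomputable def qbinom : ℕ → ℕ → Polynomial ℤ
  | _, 0 => 1
  | 0, _ + 1 => 0
  | n + 1, m + 1 => X ^ (m + 1) * qbinom n (m + 1) + qbinom n m

theorem qbinom_zero_right' (n : ℕ) : qbinom n 0 = 1 := by
  cases n <;> simp [qbinom]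

theorem qbinom_eq_zero' (n : ℕ) : ∀ m, n < m → qbinom n m = 0 := by
  induction n with
  | zero => intro m hm; cases m with
    | zero => omega
    | succ m => simp [qbinom]
  | succ n ih => intro m hm; cases m with
    | zero => omega
    | succ m => rw [qbinom, ih (m+1) (by omega), ih m (by omega)]; simp

theorem qbinom_pascal' (n : ℕ) : ∀ m, X ^ m * qbinom (n+1) (m+1) =
    X ^ m * qbinom n (m+1) + X ^ n * qbinom n m := by
  induction n with
  | zero => intro m; cases m <;> simp [qbinom]
  | succ n ih =>
    intro m
    rw [qbinom]
    cases m with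
    | zero =>
      have h := ih 0
      simp only [qbinom, qbinom_zero_right'] at h ⊢
      linear_combination X * h
    | succ m =>
      have h1 := ih (m+1)
      have h2 := ih m
      have e1 : qbinom (n+1) (m+1+1) = X ^ (m+1+1) * qbinom n (m+1+1) + qbinom n (m+1) := by
        rw [qbinom]
      have e2 : qbinom (n+1) (m+1) = X ^ (m+1) * qbinom n (m+1) + qbinom n m := by
        rw [qbinom]
      linear_combination X^(m+2) * h1 + X * h2 - X^(m+1) * e1 - X^(n+1) * e2

theorem qsum_extend' (n K : ℕ) (hK : n / 2 + 1 ≤ K) :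
    ∑ j ∈ Finset.range (n / 2 + 1), (X : Polynomial ℤ) ^ (j ^ 2 + j) * qbinom (n - j) j =
    ∑ j ∈ Finset.range K, X ^ (j ^ 2 + j) * qbinom (n - j) j := by
  apply Finset.sum_subset
  · intro j; simp only [Finset.mem_range]; omega
  · intro j _ h
    simp only [Finset.mem_range] at h
    rw [qbinom_eq_zero' _ _ (by omega), mul_zero]

/-- For n ≥ 0, F̂_{n+1}(q) = Σ_{0 ≤ 2j ≤ n} q^(j²+j) [n−j choose j]_q. -/
theorem qFibHat_sum_formula (n : ℕ) :
    qFhat (n + 1) =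
      ∑ j ∈ Finset.range (n / 2 + 1), X ^ (j ^ 2 + j) * qbinom (n - j) j := by
  induction n using Nat.twoStepInduction with
  | zero => simp [qFhat, qbinom]
  | one => simp [qFhat, qbinom]
  | more n ih0 ih1 =>
    rw [qFhat, ih0, ih1, qsum_extend' (n+1) (n/2+1+1) (by omega),
      show (n+2)/2 + 1 = n/2+1+1 by omega, Finset.sum_range_succ', Finset.sum_range_succ' _ (n/2+1),
      Finset.mul_sum, add_right_comm, ← Finset.sum_add_distrib]
    simp only [qbinom_zero_right']
    congr 1
    apply Finset.sum_congr rfl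
    intro i hi
    rw [Finset.mem_range] at hi
    obtain ⟨k, rfl⟩ : ∃ k, n = i + k := ⟨n - i, by omega⟩
    rw [show i + k + 1 - (i+1) = k by omega, show i + k + 2 - (i+1) = k+1 by omega,
      show i + k - i = k by omega]
    have h := qbinom_pascal' k i
    linear_combination -X^(i^2+2*i+2) * h
end
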